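/- If the instance I' has a solution, then it has a solution P = (E_P, λ_P) with |E_P| = k + 3·C(k,2) of the following form: for each j ∈ {1,...,k}, E_P contains exactly one edge between the root r of T and the root of a vertex-gadget S_{v_{i_j}^j} corresponding to a vertex v_{i_j}^j of color class C_j, and λ_P assigns the entire star S_{v_{i_j}^j} to group G_j; for each 1 ≤ j < q ≤ k, E_P contains exactly the three edges r r_e, r_e r'_{v_i^j}, and r_e r'_{v_p^q} of a single edge-gadget T_e corresponding to an edge e = v_i^j v_p^q of M between a vertex of C_j and a vertex of C_q, and λ_P assigns the star S_e to group G_j^q; and E_P contains no other edges. -/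

import Mathlib

namespace MCC

/-- `k₀ = k + C(k,2)`. -/
def k0 (k : ℕ) : ℕ := k + Nat.choose k 2

/-- `K = k + 3·C(k,2)`, the cut budget. -/
def KK (k : ℕ) : ℕ := k + 3 * Nat.choose k 2

/-- `z = k₀² · n⁵`. -/
def z (k n : ℕ) : ℕ := (k0 k)^2 * n^5

/-- `b_j = k₀^{2j} · z` (`j` is 1-based). -/
def bb (k n j : ℕ) : ℕ := (k0 k)^(2*j) * z k n

/-- `c_j = k₀^{2(k+j)} · z` (`j` is 1-based). -/
def cc (k n j : ℕ) : ℕ := (k0 k)^(2*(k+j)) * z k n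

/-- `c_j^q = c_k · k₀^{2((j−1)k − j(j−1)/2 + q − j)}` (`j, q` are 1-based, `j < q`). -/
def cjq (k n j q : ℕ) : ℕ := cc k n k * (k0 k)^(2*((j-1)*k - j*(j-1)/2 + q - j))

/-- The number of vertices of each copy of the star `S_fix`: `c_{k−1}^k + K + 1`. -/
def fixSize (k n : ℕ) : ℕ := cjq k n (k-1) k + KK k + 1

/-- The number of vertices of the vertex-gadget star `S_{v_i^j}`:
`c_j − (k−1)·b_j − (k−1)·x_i`, for the vertex `v = (j, i)`. -/
def vgSize (k n : ℕ) (x : Fin n → ℕ) (v : Fin k × Fin n) : ℕ :=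
  cc k n (v.1.1 + 1) - (k-1) * bb k n (v.1.1 + 1) - (k-1) * x v.2

/-- The number of vertices of the star `S'_{v_i^j}`: `b_j + x_i`, for the vertex `v = (j, i)`. -/
def spSize (k n : ℕ) (x : Fin n → ℕ) (v : Fin k × Fin n) : ℕ := bb k n (v.1.1 + 1) + x v.2

/-- Index type for the edges of `M`: ordered pairs of adjacent vertices, with the endpoint of
smaller color first. Each edge of `M` appears exactly once (the coloring being proper). -/
def EIdx (k n : ℕ) (M : SimpleGraph (Fin k × Fin n)) : Type :=
  {p : (Fin k × Fin n) × (Fin k × Fin n) // M.Adj p.1 p.2 ∧ p.1.1 < p.2.1}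

/-- The number of vertices of the star `S_e` of the edge-gadget `T_e`: `c_j^q` for an edge `e`
between color classes `j < q`. -/
def seSize (k n : ℕ) {M : SimpleGraph (Fin k × Fin n)} (e : EIdx k n M) : ℕ :=
  cjq k n (e.1.1.1.1 + 1) (e.1.2.1.1 + 1)

/-- The vertex type of the tree `T` of the instance `I'`: the root `r` (the `Unit` summand);
for each vertex `v` of `M` the star `S_v` (root `none`, leaves `some _`); for each edge `e`
of `M` the edge-gadget `T_e` consisting of the star `S_e` and the two stars `S'` attached to
its two endpoints; and `K+1` copies of the star `S_fix`. -/
abbrev VV (k n : ℕ) (x : Fin n → ℕ) (M : SimpleGraph (Fin k × Fin n)) : Type :=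
  Unit ⊕
  (Σ v : Fin k × Fin n, Option (Fin (vgSize k n x v - 1))) ⊕
  (Σ e : EIdx k n M,
    (Option (Fin (seSize k n e - 1)) ⊕ Option (Fin (spSize k n x e.1.1 - 1)) ⊕
      Option (Fin (spSize k n x e.1.2 - 1)))) ⊕
  (Fin (KK k + 1) × Option (Fin (fixSize k n - 1)))

/-- Classify a vertex of an edge-gadget: which of the three stars it belongs to
(`0` for `S_e`, `1` and `2` for the two `S'`-stars) and whether it is that star's root. -/
def code {A B C : Type} : (Option A ⊕ Option B ⊕ Option C) → ℕ × Bool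
  | Sum.inl none => (0, true)
  | Sum.inl (some _) => (0, false)
  | Sum.inr (Sum.inl none) => (1, true)
  | Sum.inr (Sum.inl (some _)) => (1, false)
  | Sum.inr (Sum.inr none) => (2, true)
  | Sum.inr (Sum.inr (some _)) => (2, false)

/-- Adjacency inside an edge-gadget `T_e`: the root `r_e` of `S_e` is joined to the leaves of
`S_e` and to the roots of the two `S'`-stars, and the root of each `S'`-star is joined to
its leaves. -/
def codeRel : ℕ × Bool → ℕ × Bool → Prop
  | (0, true), (0, false) => True
  | (0, true), (1, true) => True
  | (0, true), (2, true) => True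
  | (1, true), (1, false) => True
  | (2, true), (2, false) => True
  | _, _ => False

/-- The (directed) edge relation of the tree `T` of the instance `I'`. -/
def relMCC (k n : ℕ) (x : Fin n → ℕ) (M : SimpleGraph (Fin k × Fin n)) :
    VV k n x M → VV k n x M → Prop
  | Sum.inl _, Sum.inr (Sum.inl ⟨_, d⟩) => d = none
  | Sum.inr (Sum.inl ⟨u, d⟩), Sum.inr (Sum.inl ⟨u', d'⟩) => u = u' ∧ d = none ∧ d' ≠ none
  | Sum.inl _, Sum.inr (Sum.inr (Sum.inl ⟨_, d⟩)) => code d = (0, true)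
  | Sum.inr (Sum.inr (Sum.inl ⟨e, d⟩)), Sum.inr (Sum.inr (Sum.inl ⟨e', d'⟩)) =>
      e = e' ∧ codeRel (code d) (code d')
  | Sum.inl _, Sum.inr (Sum.inr (Sum.inr (_, d))) => d = none
  | Sum.inr (Sum.inr (Sum.inr (c, d))), Sum.inr (Sum.inr (Sum.inr (c', d'))) =>
      c = c' ∧ d = none ∧ d' ≠ none
  | _, _ => False

/-- The tree `T` of the instance `I'`. -/
def TG (k n : ℕ) (x : Fin n → ℕ) (M : SimpleGraph (Fin k × Fin n)) : SimpleGraph (VV k n x M) :=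
  SimpleGraph.fromRel (relMCC k n x M)

/-- The root `r` of `T`. -/
def rootT (k n : ℕ) (x : Fin n → ℕ) (M : SimpleGraph (Fin k × Fin n)) : VV k n x M :=
  Sum.inl ()

/-- The root `r_{v_i^j}` of the vertex-gadget star `S_{v_i^j}`. -/
def vgRoot (k n : ℕ) (x : Fin n → ℕ) (M : SimpleGraph (Fin k × Fin n)) (v : Fin k × Fin n) :
    VV k n x M :=
  Sum.inr (Sum.inl ⟨v, none⟩)

/-- The root `r_e` of the star `S_e` of the edge-gadget `T_e`. -/
def seRoot (k n : ℕ) (x : Fin n → ℕ) {M : SimpleGraph (Fin k × Fin n)} (e : EIdx k n M) :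
    VV k n x M :=
  Sum.inr (Sum.inr (Sum.inl ⟨e, Sum.inl none⟩))

/-- The root `r'_{v_i^j}` of the star `S'` of the lower-colored endpoint of `e`. -/
def sp1Root (k n : ℕ) (x : Fin n → ℕ) {M : SimpleGraph (Fin k × Fin n)} (e : EIdx k n M) :
    VV k n x M :=
  Sum.inr (Sum.inr (Sum.inl ⟨e, Sum.inr (Sum.inl none)⟩))

/-- The root `r'_{v_p^q}` of the star `S'` of the higher-colored endpoint of `e`. -/
def sp2Root (k n : ℕ) (x : Fin n → ℕ) {M : SimpleGraph (Fin k × Fin n)} (e : EIdx k n M) :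
    VV k n x M :=
  Sum.inr (Sum.inr (Sum.inl ⟨e, Sum.inr (Sum.inr none)⟩))

/-- The vertex set of the vertex-gadget star `S_v`. -/
def vgSet (k n : ℕ) (x : Fin n → ℕ) (M : SimpleGraph (Fin k × Fin n)) (v : Fin k × Fin n) :
    Set (VV k n x M) :=
  {w | ∃ d, w = Sum.inr (Sum.inl ⟨v, d⟩)}

/-- The vertex set of the star `S_e` of the edge-gadget `T_e`. -/
def SeSet (k n : ℕ) (x : Fin n → ℕ) {M : SimpleGraph (Fin k × Fin n)} (e : EIdx k n M) :
    Set (VV k n x M) :=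
  {w | ∃ d, w = Sum.inr (Sum.inr (Sum.inl ⟨e, Sum.inl d⟩))}

/-- The groups of the instance `I'`: the groups `G_1, …, G_k`, the groups `G_j^q` for
`1 ≤ j < q ≤ k`, and the group `G_rest`. -/
abbrev Grp (k : ℕ) : Type := Fin k ⊕ {pq : Fin k × Fin k // pq.1 < pq.2} ⊕ Unit

/-- The group `G_j`. -/
def gCol {k : ℕ} (j : Fin k) : Grp k := Sum.inl j

/-- The group `G_j^q`. -/
def gPair {k : ℕ} (pq : {pq : Fin k × Fin k // pq.1 < pq.2}) : Grp k := Sum.inr (Sum.inl pq)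

/-- The group `G_rest`. -/
def gRest (k : ℕ) : Grp k := Sum.inr (Sum.inr ())

/-- `t = |V(T)|`. -/
noncomputable def tTot (k n : ℕ) (x : Fin n → ℕ) (M : SimpleGraph (Fin k × Fin n)) : ℕ :=
  (Set.univ : Set (VV k n x M)).ncard

/-- `t' = t − Σ_j c_j − Σ_{j<q} c_j^q`, the size of the group `G_rest`. -/
noncomputable def tRest (k n : ℕ) (x : Fin n → ℕ) (M : SimpleGraph (Fin k × Fin n)) : ℕ :=
  tTot k n x M - (∑ j : Fin k, cc k n (j.1 + 1)) -
    ∑ pq : {pq : Fin k × Fin k // pq.1 < pq.2}, cjq k n (pq.1.1.1 + 1) (pq.1.2.1 + 1)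

/-- The prescribed sizes of the groups: `G_j` has size `c_j`, `G_j^q` has size `c_j^q`,
and `G_rest` has size `t'`. -/
noncomputable def sizesMCC (k n : ℕ) (x : Fin n → ℕ) (M : SimpleGraph (Fin k × Fin n)) :
    Grp k → ℕ
  | Sum.inl j => cc k n (j.1 + 1)
  | Sum.inr (Sum.inl pq) => cjq k n (pq.1.1.1 + 1) (pq.1.2.1 + 1)
  | Sum.inr (Sum.inr _) => tRest k n x M

/-- A solution cutting at most `kk` edges: `EP` is a set of at most `kk` edges of `T`, and
`lam` assigns the connected components of `T − EP` to the groups (it is constant on each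
component) so that each group `g` receives exactly `sizes g` vertices. -/
def IsSolutionLe {V G : Type} (T : SimpleGraph V) (EP : Set (Sym2 V)) (kk : ℕ)
    (sizes : G → ℕ) (lam : V → G) : Prop :=
  EP ⊆ T.edgeSet ∧ EP.ncard ≤ kk ∧
    (∀ v w : V, (T.deleteEdges EP).Reachable v w → lam v = lam w) ∧
    ∀ g : G, {v | lam v = g}.ncard = sizes g

/-- `C` is a `P`-component: a connected component of `T − EP`. -/
def IsPComp {V : Type} (T : SimpleGraph V) (EP : Set (Sym2 V)) (C : Set V) : Prop :=
  ∃ v : V, C = {w | (T.deleteEdges EP).Reachable v w}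

/-- `M` contains a multicolored `k`-clique: one vertex of each color class, pairwise adjacent. -/
def HasMCClique (k n : ℕ) (M : SimpleGraph (Fin k × Fin n)) : Prop :=
  ∃ sel : Fin k → Fin n, ∀ j j' : Fin k, j ≠ j' → M.Adj (j, sel j) (j', sel j')

/-- The instance `I'` has a solution. -/
def HasSol (k n : ℕ) (x : Fin n → ℕ) (M : SimpleGraph (Fin k × Fin n)) : Prop :=
  ∃ (EP : Set (Sym2 (VV k n x M))) (lam : VV k n x M → Grp k),
    IsSolutionLe (TG k n x M) EP (KK k) (sizesMCC k n x M) lam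


/-- parent map -/
def par (k n : ℕ) (x : Fin n → ℕ) (M : SimpleGraph (Fin k × Fin n)) : VV k n x M → VV k n x M
  | Sum.inl _ => Sum.inl ()
  | Sum.inr (Sum.inl ⟨_, none⟩) => Sum.inl ()
  | Sum.inr (Sum.inl ⟨v, some _⟩) => Sum.inr (Sum.inl ⟨v, none⟩)
  | Sum.inr (Sum.inr (Sum.inl ⟨_, Sum.inl none⟩)) => Sum.inl ()
  | Sum.inr (Sum.inr (Sum.inl ⟨e, Sum.inl (some _)⟩)) => Sum.inr (Sum.inr (Sum.inl ⟨e, Sum.inl none⟩))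
  | Sum.inr (Sum.inr (Sum.inl ⟨e, Sum.inr (Sum.inl none)⟩)) => Sum.inr (Sum.inr (Sum.inl ⟨e, Sum.inl none⟩))
  | Sum.inr (Sum.inr (Sum.inl ⟨e, Sum.inr (Sum.inl (some _))⟩)) =>
      Sum.inr (Sum.inr (Sum.inl ⟨e, Sum.inr (Sum.inl none)⟩))
  | Sum.inr (Sum.inr (Sum.inl ⟨e, Sum.inr (Sum.inr none)⟩)) => Sum.inr (Sum.inr (Sum.inl ⟨e, Sum.inl none⟩))
  | Sum.inr (Sum.inr (Sum.inl ⟨e, Sum.inr (Sum.inr (some _))⟩)) =>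
      Sum.inr (Sum.inr (Sum.inl ⟨e, Sum.inr (Sum.inr none)⟩))
  | Sum.inr (Sum.inr (Sum.inr (_, none))) => Sum.inl ()
  | Sum.inr (Sum.inr (Sum.inr (c, some _))) => Sum.inr (Sum.inr (Sum.inr (c, none)))

theorem par_ind (k n : ℕ) (x : Fin n → ℕ) (M : SimpleGraph (Fin k × Fin n)) {P : VV k n x M → Prop}
    (h0 : P (Sum.inl ()))
    (h1 : ∀ v, P (Sum.inr (Sum.inl ⟨v, none⟩)))
    (h2 : ∀ v d, P (Sum.inr (Sum.inl ⟨v, some d⟩)))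
    (h3 : ∀ e, P (Sum.inr (Sum.inr (Sum.inl ⟨e, Sum.inl none⟩))))
    (h4 : ∀ e d, P (Sum.inr (Sum.inr (Sum.inl ⟨e, Sum.inl (some d)⟩))))
    (h5 : ∀ e, P (Sum.inr (Sum.inr (Sum.inl ⟨e, Sum.inr (Sum.inl none)⟩))))
    (h6 : ∀ e d, P (Sum.inr (Sum.inr (Sum.inl ⟨e, Sum.inr (Sum.inl (some d))⟩))))
    (h7 : ∀ e, P (Sum.inr (Sum.inr (Sum.inl ⟨e, Sum.inr (Sum.inr none)⟩))))
    (h8 : ∀ e d, P (Sum.inr (Sum.inr (Sum.inl ⟨e, Sum.inr (Sum.inr (some d))⟩))))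
    (h9 : ∀ c, P (Sum.inr (Sum.inr (Sum.inr (c, none)))))
    (h10 : ∀ c d, P (Sum.inr (Sum.inr (Sum.inr (c, some d)))))
    (w : VV k n x M) : P w := by
  rcases w with _ | ⟨v, _ | d⟩ | ⟨e, (_ | d) | (_ | d) | (_ | d)⟩ | ⟨c, _ | d⟩
  · exact h0
  · exact h1 v
  · exact h2 v d
  · exact h3 e
  · exact h4 e d
  · exact h5 e
  · exact h6 e d
  · exact h7 e
  · exact h8 e d
  · exact h9 c
  · exact h10 c d

theorem par_adj (k n : ℕ) (x : Fin n → ℕ) (M : SimpleGraph (Fin k × Fin n)) (w : VV k n x M)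
    (hw : w ≠ Sum.inl ()) : (TG k n x M).Adj (par k n x M w) w := by
  revert hw
  refine par_ind k n x M (P := fun w => w ≠ Sum.inl () → (TG k n x M).Adj (par k n x M w) w) ?_ ?_ ?_ ?_ ?_ ?_ ?_ ?_ ?_ ?_ ?_ w <;> intros <;>
    simp_all [TG, SimpleGraph.fromRel_adj, par, relMCC, code, codeRel]

theorem par3 (k n : ℕ) (x : Fin n → ℕ) (M : SimpleGraph (Fin k × Fin n)) (w : VV k n x M) :
    par k n x M (par k n x M (par k n x M w)) = Sum.inl () := by
  refine par_ind k n x M (P := fun w => par k n x M (par k n x M (par k n x M w)) = Sum.inl ()) ?_ ?_ ?_ ?_ ?_ ?_ ?_ ?_ ?_ ?_ ?_ w <;> intros <;> rfl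

/-- child to edge -/
def cedge (k n : ℕ) (x : Fin n → ℕ) (M : SimpleGraph (Fin k × Fin n)) (w : VV k n x M) :
    Sym2 (VV k n x M) := s(par k n x M w, w)

theorem par_par_eq (k n : ℕ) (x : Fin n → ℕ) (M : SimpleGraph (Fin k × Fin n)) (w : VV k n x M)
    (h : par k n x M (par k n x M w) = w) : w = Sum.inl () := by
  have h3 := par3 k n x M w
  have h3' := par3 k n x M (par k n x M w)
  rw [h] at h3 h3'
  rw [h] at h3'
  exact h3'

theorem cedge_inj (k n : ℕ) (x : Fin n → ℕ) (M : SimpleGraph (Fin k × Fin n)) :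
    Function.Injective (cedge k n x M) := by
  intro w w' h
  simp only [cedge, Sym2.eq_iff] at h
  rcases h with ⟨_, h⟩ | ⟨h1, h2⟩
  · exact h
  · have a := par_par_eq k n x M w (by rw [h1]; exact h2.symm)
    have b := par_par_eq k n x M w' (by rw [← h2]; exact h1)
    rw [a, b]

instance finEIdx (k n : ℕ) (M : SimpleGraph (Fin k × Fin n)) : Finite (EIdx k n M) := by
  unfold EIdx; infer_instance

theorem lower {V G : Type} [Finite V] (par : V → V) (lam : V → G) (K : ℕ)
    (hB : {w | lam w ≠ lam (par w)}.ncard ≤ K) (g : G) (S : Set V)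
    (hS : ∀ w ∈ S, lam (par w) = g ∨ lam w = g) : S.ncard ≤ {w | lam w = g}.ncard + K := by
  have : S ⊆ {w | lam w = g} ∪ {w | lam w ≠ lam (par w)} := by
    intro w hw
    by_cases h : lam w = g
    · left; exact h
    · right
      rcases hS w hw with h' | h'
      · show lam w ≠ _
        rw [h']; exact h
      · exact absurd h' h
  calc S.ncard ≤ _ := Set.ncard_le_ncard this (Set.toFinite _)
    _ ≤ _ := Set.ncard_union_le _ _
    _ ≤ _ := by omega

theorem upper {V G : Type} [Finite V] (par : V → V) (r : V) (h3 : ∀ w, par (par (par w)) = r)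
    (lam : V → G) (K W : ℕ)
    (hB : {w | lam w ≠ lam (par w)}.ncard ≤ K) (g : G) (hg : lam r ≠ g)
    (hW : ∀ b, lam b = g → {w | w = b ∨ par w = b ∨ par (par w) = b}.ncard ≤ W) :
    {w | lam w = g}.ncard ≤ K * W := by
  classical
  have := Fintype.ofFinite V
  have hsub : {w | lam w = g} ⊆ (((Finset.univ.filter (fun b => lam b ≠ lam (par b) ∧ lam b = g)).biUnion
      (fun b => Finset.univ.filter (fun w => w = b ∨ par w = b ∨ par (par w) = b)) : Finset V) : Set V) := by
    intro w hw
    have hw : lam w = g := hw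
    simp only [Finset.coe_biUnion, Set.mem_iUnion, Finset.mem_coe, Finset.mem_filter, Finset.mem_univ, true_and]
    by_cases a : lam w = lam (par w)
    · by_cases b : lam (par w) = lam (par (par w))
      · refine ⟨par (par w), ⟨?_, ?_⟩, Or.inr (Or.inr rfl)⟩
        · rw [h3, ← b, ← a, hw]; exact hg.symm
        · rw [← b, ← a, hw]
      · exact ⟨par w, ⟨b, by rw [← a, hw]⟩, Or.inr (Or.inl rfl)⟩
    · exact ⟨w, ⟨a, hw⟩, Or.inl rfl⟩
  have h1 := Set.ncard_le_ncard hsub (Set.toFinite _)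
  rw [Set.ncard_coe_finset] at h1
  refine h1.trans ((Finset.card_biUnion_le_card_mul _ _ W ?_).trans ?_)
  · intro b hb
    simp only [Finset.mem_filter, Finset.mem_univ, true_and] at hb
    have := hW b hb.2
    rw [Set.ncard_eq_toFinset_card'] at this
    simpa using this
  · apply Nat.mul_le_mul_right
    refine le_trans ?_ hB
    rw [← Set.ncard_coe_finset]
    apply Set.ncard_le_ncard _ (Set.toFinite _)
    intro b hb
    simp only [Finset.coe_filter, Finset.mem_univ, true_and, Set.mem_ofPred_eq] at hb
    exact hb.1

/-- level sizes -/
def SL (k n m : ℕ) : ℕ := (k0 k)^(2*(k+m)) * z k n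

/-- pair index -/
def idx (k j q : ℕ) : ℕ := (j-1)*k - j*(j-1)/2 + q - j

theorem cjq_eq (k n j q : ℕ) : cjq k n j q = SL k n (k + idx k j q) := by
  unfold cjq SL cc idx
  generalize ((j-1)*k - j*(j-1)/2 + q - j) = t
  rw [show 2 * (k + (k+t)) = 2*(k+k) + 2 * t by ring, pow_add]; ring

/-- auxiliary -/
def gg (k j : ℕ) : ℕ := (j-1)*k - j*(j-1)/2

theorem gg_succ (k j : ℕ) (hj : 1 ≤ j) (hjk : j ≤ k) : gg k (j+1) + j = gg k j + k ∧ j ≤ gg k j + j := by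
  obtain ⟨i, rfl⟩ : ∃ i, j = i + 1 := ⟨j-1, by omega⟩
  unfold gg
  have e1 : (i+1+1)*(i+1+1-1)/2 = (i+1)*(i+1-1)/2 + (i+1) := by
    have : (i+1+1)*(i+1+1-1) = (i+1)*(i+1-1) + 2 * (i+1) := by
      simp only [Nat.add_sub_cancel]; ring
    rw [this]; omega
  rw [e1]
  have e2 : (i+1)*(i+1-1)/2 ≤ i * k := by
    simp only [Nat.add_sub_cancel]
    apply Nat.div_le_of_le_mul
    nlinarith
  have e3 : (i+1+1-1)*k = i*k + k := by simp only [Nat.add_sub_cancel]; ring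
  rw [e3]
  simp only [Nat.add_sub_cancel] at *
  omega

theorem gg_mono (k a b : ℕ) (ha : 1 ≤ a) (hab : a ≤ b) (hb : b ≤ k) : gg k a ≤ gg k b := by
  induction b, hab using Nat.le_induction with
  | base => rfl
  | succ b hab ih =>
    have := gg_succ k b (by omega) (by omega)
    have := ih (by omega)
    omega

theorem idx_bounds (k j q : ℕ) (hj : 1 ≤ j) (hjq : j < q) (hq : q ≤ k) :
    idx k j q + j = gg k j + q ∧ gg k j < idx k j q ∧ idx k j q ≤ gg k (j+1) ∧ 
      idx k j q ≤ idx k (k-1) k := by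
  have h1 : idx k j q = gg k j + q - j := rfl
  have h2 : idx k (k-1) k = gg k (k-1) + k - (k-1) := rfl
  have := gg_succ k j hj (by omega)
  have h4 := gg_succ k (k-1) (by omega) (by omega)
  rw [show k - 1 + 1 = k by omega] at h4
  have := gg_mono k (j+1) k (by omega) (by omega) le_rfl
  omega

theorem idx_inj (k j q j' q' : ℕ) (hj : 1 ≤ j) (hjq : j < q) (hq : q ≤ k)
    (hj' : 1 ≤ j') (hjq' : j' < q') (hq' : q' ≤ k) (h : idx k j q = idx k j' q') : j = j' ∧ q = q' := by
  have a := idx_bounds k j q hj hjq hq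
  have b := idx_bounds k j' q' hj' hjq' hq'
  rcases lt_trichotomy j j' with c | c | c
  · have := gg_mono k (j+1) j' (by omega) (by omega) (by omega)
    omega
  · subst c; omega
  · have := gg_mono k (j'+1) j (by omega) (by omega) (by omega)
    omega

section arith
variable (k n : ℕ) (hk : 2 ≤ k) (hn : 1 ≤ n)

theorem choose_pos2 (hk : 2 ≤ k) : 1 ≤ Nat.choose k 2 := Nat.choose_pos hk

theorem k0_ge (hk : 2 ≤ k) : 3 ≤ k0 k := by
  have := choose_pos2 k hk
  unfold k0; omega

theorem KK_le (hk : 2 ≤ k) : KK k + 4 ≤ 3 * k0 k := by unfold KK k0; omega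

theorem n5_pos (hn : 1 ≤ n) : 1 ≤ n^5 := Nat.one_le_pow _ _ hn

theorem SL_succ (m : ℕ) : SL k n (m+1) = (k0 k)^2 * SL k n m := by
  unfold SL; rw [show 2*(k+(m+1)) = 2*(k+m)+2 by ring, pow_add]; ring

theorem SL_mono (hk : 2 ≤ k) {a b : ℕ} (h : a ≤ b) : SL k n a ≤ SL k n b := by
  unfold SL
  apply Nat.mul_le_mul_right
  apply Nat.pow_le_pow_right
  · have := k0_ge k hk; omega
  · omega

theorem nine_SL (hk : 2 ≤ k) {a b : ℕ} (h : a < b) : 9 * SL k n a ≤ SL k n b := by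
  refine le_trans ?_ (SL_mono k n hk h)
  rw [Nat.succ_eq_add_one, SL_succ]
  apply Nat.mul_le_mul_right
  have := k0_ge k hk
  nlinarith

theorem z_ge (hk : 2 ≤ k) (hn : 1 ≤ n) : 9 * n^5 ≤ z k n ∧ 3 * k0 k ≤ z k n := by
  have h3 := k0_ge k hk
  have h5 := n5_pos n hn
  unfold z
  constructor
  · apply Nat.mul_le_mul_right; nlinarith
  · calc 3 * k0 k ≤ (k0 k)^2 * 1 := by nlinarith
      _ ≤ _ := Nat.mul_le_mul_left _ h5

theorem bb_ge (hk : 2 ≤ k) (j : ℕ) : z k n ≤ bb k n j := by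
  unfold bb
  have := k0_ge k hk
  exact Nat.le_mul_of_pos_left _ (by positivity)

theorem bb_le (hk : 2 ≤ k) (j : ℕ) (hj : j ≤ k) : bb k n j ≤ SL k n 0 := by
  unfold bb SL
  have := k0_ge k hk
  apply Nat.mul_le_mul_right
  apply Nat.pow_le_pow_right <;> omega

theorem KK_lt_bb (hk : 2 ≤ k) (hn : 1 ≤ n) (j : ℕ) : KK k < bb k n j := by
  have := bb_ge k n hk j
  have := z_ge k n hk hn
  have := KK_le k hk
  omega

theorem SL_ge (hk : 2 ≤ k) (m : ℕ) : z k n ≤ SL k n m := by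
  unfold SL
  have := k0_ge k hk
  exact Nat.le_mul_of_pos_left _ (by positivity)

theorem bb_SL (hk : 2 ≤ k) (j : ℕ) : 27 * ((k-1) * bb k n j) ≤ SL k n j := by
  have h3 := k0_ge k hk
  have e : SL k n j = (k0 k)^(2*k) * bb k n j := by
    unfold SL bb; rw [show 2*(k+j) = 2*k+2*j by ring, pow_add]; ring
  rw [e, ← mul_assoc]
  apply Nat.mul_le_mul_right
  have h4 : (k0 k)^4 ≤ (k0 k)^(2*k) := Nat.pow_le_pow_right (by omega) (by omega)
  have hkk : k - 1 ≤ k0 k := by unfold k0; omega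
  have : 27 * k0 k ≤ (k0 k)^4 := by
    have : 3^3 ≤ (k0 k)^3 := Nat.pow_le_pow_left h3 3
    calc 27 * k0 k ≤ (k0 k)^3 * k0 k := Nat.mul_le_mul_right _ this
      _ = _ := by ring
  omega

variable (x : Fin n → ℕ) (hx : ∀ i, x i ≤ n^4)

theorem x_le (hn : 1 ≤ n) (hx : ∀ i, x i ≤ n^4) (i : Fin n) : x i ≤ n^5 :=
  (hx i).trans (Nat.pow_le_pow_right hn (by norm_num))

theorem sp_le (hk : 2 ≤ k) (hn : 1 ≤ n) (hx : ∀ i, x i ≤ n^4) (v : Fin k × Fin n) :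
    3 * spSize k n x v ≤ 4 * SL k n 0 := by
  unfold spSize
  have := x_le n x hn hx v.2
  have := bb_le k n hk (v.1.1+1) (by omega)
  have := z_ge k n hk hn
  have := SL_ge k n hk 0
  omega

theorem vg_le (v : Fin k × Fin n) : vgSize k n x v ≤ SL k n (v.1.1+1) := by
  unfold vgSize SL cc; omega

theorem vg_gt (hk : 2 ≤ k) (hn : 1 ≤ n) (hx : ∀ i, x i ≤ n^4) (v : Fin k × Fin n) (m : ℕ)
    (hm : m < v.1.1 + 1) : SL k n m + KK k < vgSize k n x v := by
  have h1 : vgSize k n x v = SL k n (v.1.1+1) - (k-1) * bb k n (v.1.1 + 1) - (k-1) * x v.2 := rfl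
  have h2 := nine_SL k n hk hm
  have h3 := bb_SL k n hk (v.1.1+1)
  have h4 : (k-1) * x v.2 ≤ (k-1) * bb k n (v.1.1 + 1) := by
    apply Nat.mul_le_mul_left
    have := x_le n x hn hx v.2
    have := z_ge k n hk hn
    have := bb_ge k n hk (v.1.1+1)
    omega
  have h5 : bb k n (v.1.1+1) ≤ (k-1) * bb k n (v.1.1 + 1) := Nat.le_mul_of_pos_left _ (by omega)
  have h6 := KK_lt_bb k n hk hn (v.1.1+1)
  omega

theorem final_arith (hk : 2 ≤ k) (hn : 1 ≤ n) (m W : ℕ) (h : SL k n (m+1) ≤ KK k * W) (hW : 3 * W ≤ 4 * SL k n m) : False := by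
  rw [SL_succ] at h
  have h1 := KK_le k hk
  have h2 := SL_ge k n hk m
  have h3 := z_ge k n hk hn
  have h4 := k0_ge k hk
  have h5 : KK k * (3 * W) ≤ KK k * (4 * SL k n m) := Nat.mul_le_mul_left _ hW
  have h6 : 4 * KK k < 3 * (k0 k)^2 := by
    zify at *
    nlinarith [sq_nonneg ((k0 k : ℤ) - 2)]
  have h7 : 4 * KK k * SL k n m < 3 * (k0 k)^2 * SL k n m := Nat.mul_lt_mul_of_pos_right h6 (by omega)
  nlinarith

end arith

theorem ncard_rng {α V : Type} [Finite α] (f : α → V) : (Set.range f).ncard ≤ Nat.card α := by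
  rw [← Set.image_univ, ← Set.ncard_univ]
  exact Set.ncard_image_le (Set.toFinite _)

theorem ncard_rng_inj {α V : Type} (f : α → V) (hf : Function.Injective f) :
    (Set.range f).ncard = Nat.card α := by
  rw [← Set.image_univ, ← Set.ncard_univ]
  exact Set.ncard_image_of_injective _ hf

theorem card_opt (a : ℕ) : Nat.card (Option (Fin a)) = a + 1 := by simp

theorem leafD {V : Type} (par : V → V) (b : V) (h : ∀ w, par w ≠ b) :
    {w | w = b ∨ par w = b ∨ par (par w) = b}.ncard ≤ 1 := by
  have : {w | w = b ∨ par w = b ∨ par (par w) = b} = {b} := by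
    ext w; simp [h]
  rw [this]; simp

theorem key (k n : ℕ) (hk : 2 ≤ k) (hn : 1 ≤ n) (x : Fin n → ℕ) (hx : ∀ i, x i ≤ n^4)
    (M : SimpleGraph (Fin k × Fin n)) (lam : VV k n x M → Grp k)
    (hB : {w | lam w ≠ lam (par k n x M w)}.ncard ≤ KK k) (g : Grp k)
    (hr : lam (Sum.inl ()) ≠ g) (m : ℕ) (hm : m + 1 ≤ k + idx k (k-1) k)
    (hA : {w | lam w = g}.ncard = SL k n (m+1)) :
    (∃ v, lam (vgRoot k n x M v) = g ∧ v.1.1 + 1 = m + 1) ∨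
    ∃ e : EIdx k n M, lam (seRoot k n x e) = g ∧ k + idx k (e.1.1.1.1+1) (e.1.2.1.1+1) = m+1 := by
  by_contra hcon
  push Not at hcon
  obtain ⟨hv, he⟩ := hcon
  have hz := z_ge k n hk hn
  have hSm := SL_ge k n hk m
  have h3 := k0_ge k hk
  have hm0 : SL k n 0 ≤ SL k n m := SL_mono k n hk (Nat.zero_le _)
  have one_le : 1 ≤ 4 * SL k n m / 3 := by omega
  have hfix : fixSize k n = SL k n (k + idx k (k-1) k) + KK k + 1 := by
    unfold fixSize; rw [cjq_eq]
  have hSmx := SL_mono k n hk hm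
  have hKb := KK_lt_bb k n hk hn
  have := upper (par k n x M) (Sum.inl ()) (par3 k n x M) lam (KK k) (4 * SL k n m / 3) hB g hr ?_
  · rw [hA] at this
    exact final_arith k n hk hn m _ this (by omega)
  intro b
  refine par_ind k n x M (P := fun b => lam b = g → {w | w = b ∨ par k n x M w = b ∨ par k n x M (par k n x M w) = b}.ncard ≤ 4 * SL k n m / 3)
    ?_ ?_ ?_ ?_ ?_ ?_ ?_ ?_ ?_ ?_ ?_ b
  · intro h; exact absurd h hr
  · intro v hvg
    have hne := hv v hvg
    have hlt : v.1.1 + 1 < m + 1 := by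
      by_contra hge
      have hgt := vg_gt k n x hk hn hx v (m+1) (by omega)
      have hl := lower (par k n x M) lam (KK k) hB g
        (Set.range (fun d => (Sum.inr (Sum.inl ⟨v, d⟩) : VV k n x M))) (by
          rintro _ ⟨_ | d, rfl⟩
          · right; exact hvg
          · left; exact hvg)
      rw [ncard_rng_inj _ (by intro a b h; simpa using h), card_opt, hA] at hl
      omega
    refine le_trans (Set.ncard_le_ncard (t := Set.range (fun d => (Sum.inr (Sum.inl ⟨v, d⟩) : VV k n x M))) ?_ (Set.toFinite _)) ?_
    · intro w
      rcases w with _ | ⟨v, _ | d⟩ | ⟨e', (_ | d) | (_ | d) | (_ | d)⟩ | ⟨c, _ | d⟩ <;> rintro (h | h | h) <;>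
        (cases h <;> exact ⟨_, rfl⟩)
    · refine (ncard_rng _).trans ?_
      rw [card_opt]
      have := vg_le k n x v
      have := SL_mono k n hk (show v.1.1 + 1 ≤ m by omega)
      omega
  · intro v d _
    refine (leafD _ _ ?_).trans one_le
    intro w
    refine par_ind k n x M (P := fun w => par k n x M w ≠ Sum.inr (Sum.inl ⟨v, some d⟩)) ?_ ?_ ?_ ?_ ?_ ?_ ?_ ?_ ?_ ?_ ?_ w <;> intros <;> simp [par]
    rintro rfl; simp
  · intro e heg
    have hne := he e heg
    have hse : seSize k n e = SL k n (k + idx k (e.1.1.1.1+1) (e.1.2.1.1+1)) := by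
      unfold seSize; rw [cjq_eq]
    have hlt : k + idx k (e.1.1.1.1+1) (e.1.2.1.1+1) < m + 1 := by
      by_contra hge
      have hgt := nine_SL k n hk (show m + 1 < k + idx k (e.1.1.1.1+1) (e.1.2.1.1+1) by omega)
      have hl := lower (par k n x M) lam (KK k) hB g
        (Set.range (fun d => (Sum.inr (Sum.inr (Sum.inl ⟨e, Sum.inl d⟩)) : VV k n x M))) (by
          rintro _ ⟨_ | d, rfl⟩
          · right; exact heg
          · left; exact heg)
      rw [ncard_rng_inj _ (by intro a b h; simpa using h), card_opt, hA] at hl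
      have := KK_le k hk
      have := SL_ge k n hk (m+1)
      omega
    refine le_trans (Set.ncard_le_ncard (t := Set.range (fun d => (Sum.inr (Sum.inr (Sum.inl ⟨e, d⟩)) : VV k n x M))) ?_ (Set.toFinite _)) ?_
    · intro w
      rcases w with _ | ⟨v, _ | d⟩ | ⟨e', (_ | d) | (_ | d) | (_ | d)⟩ | ⟨c, _ | d⟩ <;> rintro (h | h | h) <;>
        (cases h <;> exact ⟨_, rfl⟩)
    · refine (ncard_rng _).trans ?_
      rw [Nat.card_sum, Nat.card_sum, card_opt, card_opt, card_opt]
      have a1 := sp_le k n x hk hn hx e.1.1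
      have a2 := sp_le k n x hk hn hx e.1.2
      have b1 : 1 ≤ spSize k n x e.1.1 := by
        have := hKb (e.1.1.1.1+1); unfold spSize; omega
      have b2 : 1 ≤ spSize k n x e.1.2 := by
        have := hKb (e.1.2.1.1+1); unfold spSize; omega
      have c1 := SL_mono k n hk (show k + idx k (e.1.1.1.1+1) (e.1.2.1.1+1) ≤ m by omega)
      have c2 := nine_SL k n hk (show 0 < k + idx k (e.1.1.1.1+1) (e.1.2.1.1+1) by omega)
      have c3 := SL_ge k n hk (k + idx k (e.1.1.1.1+1) (e.1.2.1.1+1))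
      omega
  · intro e d _
    refine (leafD _ _ ?_).trans one_le
    intro w
    rcases w with _ | ⟨v, _ | d⟩ | ⟨e', (_ | d) | (_ | d) | (_ | d)⟩ | ⟨c, _ | d⟩ <;> simp [par]
    all_goals (rintro rfl; simp)
  · intro e _
    refine le_trans (Set.ncard_le_ncard (t := Set.range (fun d => (Sum.inr (Sum.inr (Sum.inl ⟨e, Sum.inr (Sum.inl d)⟩)) : VV k n x M))) ?_ (Set.toFinite _)) ?_
    · intro w
      rcases w with _ | ⟨v, _ | d⟩ | ⟨e', (_ | d) | (_ | d) | (_ | d)⟩ | ⟨c, _ | d⟩ <;> rintro (h | h | h) <;>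
        (cases h <;> exact ⟨_, rfl⟩)
    · refine (ncard_rng _).trans ?_
      rw [card_opt]
      have a1 := sp_le k n x hk hn hx e.1.1
      omega
  · intro e d _
    refine (leafD _ _ ?_).trans one_le
    intro w
    rcases w with _ | ⟨v, _ | d⟩ | ⟨e', (_ | d) | (_ | d) | (_ | d)⟩ | ⟨c, _ | d⟩ <;> simp [par]
    all_goals (rintro rfl; simp)
  · intro e _
    refine le_trans (Set.ncard_le_ncard (t := Set.range (fun d => (Sum.inr (Sum.inr (Sum.inl ⟨e, Sum.inr (Sum.inr d)⟩)) : VV k n x M))) ?_ (Set.toFinite _)) ?_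
    · intro w
      rcases w with _ | ⟨v, _ | d⟩ | ⟨e', (_ | d) | (_ | d) | (_ | d)⟩ | ⟨c, _ | d⟩ <;> rintro (h | h | h) <;>
        (cases h <;> exact ⟨_, rfl⟩)
    · refine (ncard_rng _).trans ?_
      rw [card_opt]
      have a1 := sp_le k n x hk hn hx e.1.2
      omega
  · intro e d _
    refine (leafD _ _ ?_).trans one_le
    intro w
    rcases w with _ | ⟨v, _ | d⟩ | ⟨e', (_ | d) | (_ | d) | (_ | d)⟩ | ⟨c, _ | d⟩ <;> simp [par]
    all_goals (rintro rfl; simp)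
  · intro c hc
    exfalso
    have hl := lower (par k n x M) lam (KK k) hB g
        (Set.range (fun d => (Sum.inr (Sum.inr (Sum.inr (c, d))) : VV k n x M))) (by
          rintro _ ⟨_ | d, rfl⟩
          · right; exact hc
          · left; exact hc)
    rw [ncard_rng_inj _ (by intro a b h; simpa using h), card_opt, hA] at hl
    omega
  · intro c d _
    refine (leafD _ _ ?_).trans one_le
    intro w
    rcases w with _ | ⟨v, _ | d⟩ | ⟨e', (_ | d) | (_ | d) | (_ | d)⟩ | ⟨c, _ | d⟩ <;> simp [par]

theorem card_pairs (k : ℕ) : Nat.card {pq : Fin k × Fin k // pq.1 < pq.2} = Nat.choose k 2 := by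
  classical
  rw [Nat.card_eq_fintype_card, Fintype.card_subtype]
  have : (Finset.univ.filter (fun pq : Fin k × Fin k => pq.1 < pq.2)).card
      = ∑ q : Fin k, (Finset.univ.filter (fun p : Fin k => p < q)).card := by
    simp only [Finset.card_filter]
    rw [Fintype.sum_prod_type, Finset.sum_comm]
  rw [this]
  have h2 : ∀ q : Fin k, (Finset.univ.filter (fun p : Fin k => p < q)).card = q.1 := by
    intro q
    rw [show Finset.univ.filter (fun p : Fin k => p < q) = Finset.Iio q by ext; simp, Fin.card_Iio]
  simp only [h2]
  rw [Fin.sum_univ_eq_sum_range (fun i => i) k, Finset.sum_range_id, Nat.choose_two_right]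

theorem root_rest (k n : ℕ) (x : Fin n → ℕ)
    (M : SimpleGraph (Fin k × Fin n)) (lam : VV k n x M → Grp k)
    (hB : {w | lam w ≠ lam (par k n x M w)}.ncard ≤ KK k)
    (hA : {w | lam w = lam (Sum.inl ())}.ncard < fixSize k n) : False := by
  have h : ∀ c : Fin (KK k + 1), ∃ d, lam (Sum.inr (Sum.inr (Sum.inr (c, d)))) ≠
      lam (par k n x M (Sum.inr (Sum.inr (Sum.inr (c, d))))) := by
    intro c
    by_contra hc
    push Not at hc
    have h0 : lam (Sum.inr (Sum.inr (Sum.inr (c, none)))) = lam (Sum.inl ()) := hc none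
    have h1 : Set.range (fun d => (Sum.inr (Sum.inr (Sum.inr (c, d))) : VV k n x M)) ⊆
        {w | lam w = lam (Sum.inl ())} := by
      rintro _ ⟨_ | d, rfl⟩
      · exact h0
      · exact (hc (some d)).trans h0
    have h2 := Set.ncard_le_ncard h1 (Set.toFinite _)
    rw [ncard_rng_inj _ (by intro a b h; simpa using h), card_opt] at h2
    have h3 := lt_of_le_of_lt h2 hA
    omega
  choose d hd using h
  have h1 : Set.range (fun c => (Sum.inr (Sum.inr (Sum.inr (c, d c))) : VV k n x M)) ⊆
      {w | lam w ≠ lam (par k n x M w)} := by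
    rintro _ ⟨c, rfl⟩
    exact hd c
  have h2 := Set.ncard_le_ncard h1 (Set.toFinite _)
  rw [ncard_rng_inj _ (by intro a b h; simp at h; exact h.1)] at h2
  rw [Nat.card_eq_fintype_card, Fintype.card_fin] at h2
  have h3 := h2.trans hB
  omega

/-- chosen children -/
def phi (k n : ℕ) (x : Fin n → ℕ) (M : SimpleGraph (Fin k × Fin n)) (sel : Fin k → Fin n)
    (ed : {pq : Fin k × Fin k // pq.1 < pq.2} → EIdx k n M) :
    Fin k ⊕ ({pq : Fin k × Fin k // pq.1 < pq.2} × Fin 3) → VV k n x M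
  | Sum.inl j => vgRoot k n x M (j, sel j)
  | Sum.inr (pq, 0) => seRoot k n x (ed pq)
  | Sum.inr (pq, 1) => sp1Root k n x (ed pq)
  | Sum.inr (pq, 2) => sp2Root k n x (ed pq)

theorem phi_inj (k n : ℕ) (x : Fin n → ℕ) (M : SimpleGraph (Fin k × Fin n)) (sel : Fin k → Fin n)
    (ed : {pq : Fin k × Fin k // pq.1 < pq.2} → EIdx k n M) (hed : Function.Injective ed) :
    Function.Injective (phi k n x M sel ed) := by
  have aux : ∀ (a b : Fin 3) (p q : {pq : Fin k × Fin k // pq.1 < pq.2}),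
      phi k n x M sel ed (Sum.inr (p, a)) = phi k n x M sel ed (Sum.inr (q, b)) → p = q ∧ a = b := by
    intro a b p q h
    have h' : ed p = ed q := by
      fin_cases a <;> fin_cases b <;> simp [phi, seRoot, sp1Root, sp2Root] at h <;> 
        first | exact h | exact h.1
    refine ⟨hed h', ?_⟩
    have := hed h'
    subst this
    fin_cases a <;> fin_cases b <;> simp [phi, seRoot, sp1Root, sp2Root] at h ⊢
  rintro (i | ⟨p, a⟩) (j | ⟨q, b⟩) h
  · simp [phi, vgRoot] at h; rw [h.1.1]
  · fin_cases b <;> simp [phi, vgRoot, seRoot, sp1Root, sp2Root] at h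
  · fin_cases a <;> simp [phi, vgRoot, seRoot, sp1Root, sp2Root] at h
  · obtain ⟨rfl, rfl⟩ := aux a b p q h; rfl

theorem target_eq (k n : ℕ) (x : Fin n → ℕ) (M : SimpleGraph (Fin k × Fin n)) (sel : Fin k → Fin n)
    (ed : {pq : Fin k × Fin k // pq.1 < pq.2} → EIdx k n M) :
    Set.range (fun a => cedge k n x M (phi k n x M sel ed a)) = 
     (Set.range fun j : Fin k => s(rootT k n x M, vgRoot k n x M (j, sel j))) ∪
        (⋃ pq : {pq : Fin k × Fin k // pq.1 < pq.2},
          {s(rootT k n x M, seRoot k n x (ed pq)),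
           s(seRoot k n x (ed pq), sp1Root k n x (ed pq)),
           s(seRoot k n x (ed pq), sp2Root k n x (ed pq))}) := by
  apply Set.Subset.antisymm
  · rintro _ ⟨j | ⟨pq, a⟩, rfl⟩
    · left; exact ⟨j, rfl⟩
    · right
      refine Set.mem_iUnion.2 ⟨pq, ?_⟩
      fin_cases a
      · left; rfl
      · right; left; rfl
      · right; right; rfl
  · apply Set.union_subset
    · rintro _ ⟨j, rfl⟩; exact ⟨Sum.inl j, rfl⟩
    · apply Set.iUnion_subset
      rintro pq e (rfl | rfl | rfl)
      · exact ⟨Sum.inr (pq, 0), rfl⟩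
      · exact ⟨Sum.inr (pq, 1), rfl⟩
      · exact ⟨Sum.inr (pq, 2), rfl⟩

end MCC

open MCC

/-- Corollary 1 of the paper: if the instance `I'` has a solution, then it has a solution
`P` cutting exactly `K = k + 3·C(k,2)` edges of the following form: for each color `j`,
exactly one edge between `r` and the root of a vertex-gadget `S_{v_{i_j}^j}` of color class
`C_j`, with the entire star assigned to `G_j`; for each pair `j < q`, exactly the three
edges `r r_e`, `r_e r'` and `r_e r''` of a single edge-gadget `T_e` corresponding to an
edge of `M` between `C_j` and `C_q`, with the star `S_e` assigned to `G_j^q`; and no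
other edges. -/
theorem statement10
    (k n : ℕ) (hk : 2 ≤ k) (hn : 1 ≤ n)
    (x : Fin n → ℕ) (hxinj : Function.Injective x) (hxbd : ∀ i, x i ≤ n^4)
    (hxna : ∀ (g : Fin (k-1) → Fin n) (i : Fin n),
      (∑ j, x (g j)) = (k-1) * x i → ∀ j, x (g j) = x i)
    (M : SimpleGraph (Fin k × Fin n)) (hM : ∀ u w, M.Adj u w → u.1 ≠ w.1)
    (hsol : HasSol k n x M) :
    ∃ (EP : Set (Sym2 (VV k n x M))) (lam : VV k n x M → Grp k)
      (sel : Fin k → Fin n) (ed : {pq : Fin k × Fin k // pq.1 < pq.2} → EIdx k n M),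
      IsSolutionLe (TG k n x M) EP (KK k) (sizesMCC k n x M) lam ∧
      EP.ncard = KK k ∧
      (∀ pq : {pq : Fin k × Fin k // pq.1 < pq.2},
        (ed pq).1.1.1 = pq.1.1 ∧ (ed pq).1.2.1 = pq.1.2) ∧
      EP = (Set.range fun j : Fin k => s(rootT k n x M, vgRoot k n x M (j, sel j))) ∪
        (⋃ pq : {pq : Fin k × Fin k // pq.1 < pq.2},
          {s(rootT k n x M, seRoot k n x (ed pq)),
           s(seRoot k n x (ed pq), sp1Root k n x (ed pq)),
           s(seRoot k n x (ed pq), sp2Root k n x (ed pq))}) ∧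
      (∀ j : Fin k, ∀ w ∈ vgSet k n x M (j, sel j), lam w = gCol j) ∧
      (∀ pq : {pq : Fin k × Fin k // pq.1 < pq.2},
        ∀ w ∈ SeSet k n x (ed pq), lam w = gPair pq) := by
  classical
  obtain ⟨EP, lam, hs⟩ := hsol
  obtain ⟨hsub, hcard, hconst, hsizes⟩ := id hs
  have hcut : ∀ w, lam w ≠ lam (par k n x M w) → cedge k n x M w ∈ EP := by
    intro w hw
    by_contra hne
    apply hw
    symm
    apply hconst
    apply SimpleGraph.Adj.reachable
    rw [SimpleGraph.deleteEdges_adj]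
    refine ⟨par_adj k n x M w ?_, hne⟩
    rintro rfl
    exact hw rfl
  have hB : {w | lam w ≠ lam (par k n x M w)}.ncard ≤ KK k := by
    rw [← Set.ncard_image_of_injective _ (cedge_inj k n x M)]
    refine (Set.ncard_le_ncard ?_ (Set.toFinite _)).trans hcard
    rintro _ ⟨w, hw, rfl⟩
    exact hcut w hw
  have hidx : ∀ pq : {pq : Fin k × Fin k // pq.1 < pq.2},
      0 < idx k (pq.1.1.1+1) (pq.1.2.1+1) ∧ idx k (pq.1.1.1+1) (pq.1.2.1+1) ≤ idx k (k-1) k := by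
    intro pq
    have h2 : pq.1.1.1 < pq.1.2.1 := pq.2
    have := idx_bounds k (pq.1.1.1+1) (pq.1.2.1+1) (by omega) (by omega) (by omega)
    omega
  have hcolS : ∀ j : Fin k, {w | lam w = gCol j}.ncard = SL k n (j.1+1) := fun j => hsizes (gCol j)
  have hpairS : ∀ pq : {pq : Fin k × Fin k // pq.1 < pq.2},
      {w | lam w = gPair pq}.ncard = SL k n (k + idx k (pq.1.1.1+1) (pq.1.2.1+1)) := by
    intro pq
    rw [← cjq_eq]
    exact hsizes (gPair pq)
  have hfix : fixSize k n = SL k n (k + idx k (k-1) k) + KK k + 1 := by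
    unfold fixSize; rw [cjq_eq]
  have hrc : ∀ j, lam (Sum.inl ()) ≠ gCol j := by
    intro j hj
    apply root_rest k n x M lam hB
    rw [hj, hcolS, hfix]
    have := SL_mono k n hk (show j.1+1 ≤ k + idx k (k-1) k by omega)
    omega
  have hrp : ∀ pq, lam (Sum.inl ()) ≠ gPair pq := by
    intro pq hj
    apply root_rest k n x M lam hB
    rw [hj, hpairS, hfix]
    have := hidx pq
    have := SL_mono k n hk (show k + idx k (pq.1.1.1+1) (pq.1.2.1+1) ≤ k + idx k (k-1) k by omega)
    omega
  have heidx : ∀ e : EIdx k n M, 0 < idx k (e.1.1.1.1+1) (e.1.2.1.1+1) := fun e =>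
    (hidx ⟨(e.1.1.1, e.1.2.1), e.2.2⟩).1
  have hsel : ∀ j : Fin k, ∃ i : Fin n, lam (vgRoot k n x M (j, i)) = gCol j := by
    intro j
    rcases key k n hk hn x hxbd M lam hB (gCol j) (hrc j) j.1 (by omega) (hcolS j) with
      ⟨v, hv, h⟩ | ⟨e, _, h⟩
    · refine ⟨v.2, ?_⟩
      have : v = (j, v.2) := Prod.ext (Fin.ext (by simpa using h)) rfl
      rw [← this]; exact hv
    · have := heidx e
      omega
  have hed : ∀ pq : {pq : Fin k × Fin k // pq.1 < pq.2}, ∃ e : EIdx k n M,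
      lam (seRoot k n x e) = gPair pq ∧ e.1.1.1 = pq.1.1 ∧ e.1.2.1 = pq.1.2 := by
    intro pq
    have hi := hidx pq
    rcases key k n hk hn x hxbd M lam hB (gPair pq) (hrp pq)
      (k + idx k (pq.1.1.1+1) (pq.1.2.1+1) - 1) (by omega)
      (by rw [hpairS]; congr 1; omega) with ⟨v, _, h⟩ | ⟨e, he, h⟩
    · omega
    · refine ⟨e, he, ?_⟩
      have h1 : pq.1.1.1 < pq.1.2.1 := pq.2
      have h2 : e.1.1.1.1 < e.1.2.1.1 := e.2.2
      have := idx_inj k (e.1.1.1.1+1) (e.1.2.1.1+1) (pq.1.1.1+1) (pq.1.2.1+1) (by omega) (by omega)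
        (by omega) (by omega) (by omega) (by omega) (by omega)
      constructor <;> apply Fin.ext <;> omega
  choose sel hsel using hsel
  choose ed hed hedc using hed
  have hinj : Function.Injective ed := by
    intro p q h
    have a := hedc p
    have b := hedc q
    rw [h] at a
    apply Subtype.ext
    exact Prod.ext (a.1.symm.trans b.1) (a.2.symm.trans b.2)
  have hse : ∀ pq, seSize k n (ed pq) = SL k n (k + idx k (pq.1.1.1+1) (pq.1.2.1+1)) := by
    intro pq
    unfold seSize; rw [cjq_eq, (hedc pq).1, (hedc pq).2]
  have hsp1 : ∀ pq, lam (sp1Root k n x (ed pq)) ≠ gPair pq := by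
    intro pq h
    have hl := lower (par k n x M) lam (KK k) hB (gPair pq)
        (Set.range (Sum.elim
          (fun d => (Sum.inr (Sum.inr (Sum.inl ⟨ed pq, Sum.inl d⟩)) : VV k n x M))
          (fun d => (Sum.inr (Sum.inr (Sum.inl ⟨ed pq, Sum.inr (Sum.inl d)⟩)) : VV k n x M)))) (by
          rintro _ ⟨(_ | d) | (_ | d), rfl⟩
          · right; exact hed pq
          · left; exact hed pq
          · right; exact h
          · left; exact h)
    rw [ncard_rng_inj _ (by rintro (a | a) (b | b) h <;> simpa using h), Nat.card_sum,
      card_opt, card_opt, hpairS, ← hse] at hl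
    have := KK_lt_bb k n hk hn ((ed pq).1.1.1.1+1)
    unfold spSize at hl
    omega
  have hsp2 : ∀ pq, lam (sp2Root k n x (ed pq)) ≠ gPair pq := by
    intro pq h
    have hl := lower (par k n x M) lam (KK k) hB (gPair pq)
        (Set.range (Sum.elim
          (fun d => (Sum.inr (Sum.inr (Sum.inl ⟨ed pq, Sum.inl d⟩)) : VV k n x M))
          (fun d => (Sum.inr (Sum.inr (Sum.inl ⟨ed pq, Sum.inr (Sum.inr d)⟩)) : VV k n x M)))) (by
          rintro _ ⟨(_ | d) | (_ | d), rfl⟩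
          · right; exact hed pq
          · left; exact hed pq
          · right; exact h
          · left; exact h)
    rw [ncard_rng_inj _ (by rintro (a | a) (b | b) h <;> simpa using h), Nat.card_sum,
      card_opt, card_opt, hpairS, ← hse] at hl
    have := KK_lt_bb k n hk hn ((ed pq).1.2.1.1+1)
    unfold spSize at hl
    omega
  have htsub : Set.range (fun a => cedge k n x M (phi k n x M sel ed a)) ⊆ EP := by
    rintro _ ⟨j | ⟨pq, a⟩, rfl⟩
    · apply hcut
      show lam (vgRoot k n x M (j, sel j)) ≠ lam (Sum.inl ())
      rw [hsel]; exact (hrc j).symm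
    · apply hcut
      fin_cases a
      · show lam (seRoot k n x (ed pq)) ≠ lam (Sum.inl ())
        rw [hed]; exact (hrp pq).symm
      · show lam (sp1Root k n x (ed pq)) ≠ lam (seRoot k n x (ed pq))
        rw [hed]; exact hsp1 pq
      · show lam (sp2Root k n x (ed pq)) ≠ lam (seRoot k n x (ed pq))
        rw [hed]; exact hsp2 pq
  have htcard : (Set.range (fun a => cedge k n x M (phi k n x M sel ed a))).ncard = KK k := by
    rw [ncard_rng_inj (fun a => cedge k n x M (phi k n x M sel ed a)) ((cedge_inj k n x M).comp (phi_inj k n x M sel ed hinj)), Nat.card_sum,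
      Nat.card_prod, card_pairs]
    simp [KK, mul_comm]
  have hEP : Set.range (fun a => cedge k n x M (phi k n x M sel ed a)) = EP :=
    Set.eq_of_subset_of_ncard_le htsub (by rw [htcard]; exact hcard) (Set.toFinite _)
  have hnot : ∀ w, (∀ a, phi k n x M sel ed a ≠ w) → lam w = lam (par k n x M w) := by
    intro w hw
    by_contra h
    have := hcut w h
    rw [← hEP] at this
    obtain ⟨a, ha⟩ := this
    exact hw a (cedge_inj k n x M ha)
  refine ⟨EP, lam, sel, ed, hs, by rw [← hEP, htcard], hedc, ?_, ?_, ?_⟩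
  · rw [← target_eq, hEP]
  · rintro j w ⟨_ | d, rfl⟩
    · exact hsel j
    · refine (hnot _ ?_).trans (hsel j)
      rintro (i | ⟨pq, a⟩)
      · simp only [phi, vgRoot, ne_eq, Sum.inr.injEq, Sum.inl.injEq, Sigma.mk.injEq, not_and]
        intro h
        obtain ⟨rfl, _⟩ := Prod.ext_iff.1 h
        simp
      · fin_cases a <;> simp [phi, seRoot, sp1Root, sp2Root]
  · rintro pq w ⟨_ | d, rfl⟩
    · exact hed pq
    · refine (hnot _ ?_).trans (hed pq)
      rintro (i | ⟨pq', a⟩)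
      · simp [phi, vgRoot]
      · by_cases hpq : pq' = pq
        · subst hpq
          fin_cases a <;> simp [phi, seRoot, sp1Root, sp2Root]
        · have : ed pq' ≠ ed pq := fun h => hpq (hinj h)
          fin_cases a <;> simp [phi, seRoot, sp1Root, sp2Root, this]
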